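/- arXiv:2103.11077 — 2 statements merged into one kernel-verified Lean document; each statement's English description precedes it below -/
import Mathlib

section
/- Let p be a prime, k ≥ 1, and let i be an integer with 1 ≤ i ≤ k. Then g_{p^k}(p^i) = g_{p^k}(0). -/
/-- The permanent of a 2×2 matrix over `ZMod n`. -/
def perm2 {n : ℕ} (A : Matrix (Fin 2) (Fin 2) (ZMod n)) : ZMod n :=
  A 0 0 * A 1 1 + A 0 1 * A 1 0

/-- `g n x` is the number of invertible 2×2 matrices over `ZMod n` with permanent `x mod n`. -/
noncomputable def g (n : ℕ) (x : ℤ) : ℕ :=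
  Nat.card {A : Matrix (Fin 2) (Fin 2) (ZMod n) // IsUnit A ∧ perm2 A = (x : ZMod n)}

/-- If an invertible matrix has nilpotent permanent, then its upper left entry is a unit. -/
theorem isUnit_apply_zero_zero_of_isNilpotent_perm2 {n : ℕ}
    {A : Matrix (Fin 2) (Fin 2) (ZMod n)} (hA : IsUnit A) (h : IsNilpotent (perm2 A)) :
    IsUnit (A 0 0) := by
  have hdet : IsUnit A.det := (Matrix.isUnit_iff_isUnit_det A).1 hA
  have hsum : IsUnit (perm2 A + A.det) :=
    h.isUnit_add_right_of_commute hdet (Commute.all _ _)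
  have heq : perm2 A + A.det = A 0 0 * (2 * A 1 1) := by
    rw [perm2, Matrix.det_fin_two]
    ring
  rw [heq] at hsum
  exact isUnit_of_mul_isUnit_left hsum

/-- Change the lower right entry of `A` so that the permanent changes by `x`, provided that the
upper left entry is a unit. -/
noncomputable def shiftPerm {n : ℕ} (x : ZMod n) (A : Matrix (Fin 2) (Fin 2) (ZMod n)) :
    Matrix (Fin 2) (Fin 2) (ZMod n) :=
  !![A 0 0, A 0 1; A 1 0, A 1 1 + Ring.inverse (A 0 0) * x]

theorem perm2_shiftPerm {n : ℕ} (x : ZMod n) {A : Matrix (Fin 2) (Fin 2) (ZMod n)}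
    (h : IsUnit (A 0 0)) : perm2 (shiftPerm x A) = perm2 A + x := by
  have h' := Ring.mul_inverse_cancel _ h
  simp only [perm2, shiftPerm, Matrix.of_apply, Matrix.cons_val', Matrix.cons_val_zero,
    Matrix.cons_val_one, Matrix.cons_val_fin_one]
  linear_combination x * h'

theorem isUnit_shiftPerm {n : ℕ} {x : ZMod n} (hx : IsNilpotent x)
    {A : Matrix (Fin 2) (Fin 2) (ZMod n)} (hA : IsUnit A) (h : IsUnit (A 0 0)) :
    IsUnit (shiftPerm x A) := by
  have hdet : IsUnit A.det := (Matrix.isUnit_iff_isUnit_det A).1 hA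
  have heq : (shiftPerm x A).det = x + A.det := by
    have h' := Ring.mul_inverse_cancel _ h
    rw [shiftPerm, Matrix.det_fin_two_of, Matrix.det_fin_two]
    linear_combination x * h'
  rw [Matrix.isUnit_iff_isUnit_det, heq]
  exact hx.isUnit_add_right_of_commute hdet (Commute.all _ _)

theorem shiftPerm_shiftPerm {n : ℕ} {x y : ZMod n} (hxy : x + y = 0)
    (A : Matrix (Fin 2) (Fin 2) (ZMod n)) : shiftPerm x (shiftPerm y A) = A := by
  ext i j
  fin_cases i <;> fin_cases j <;> simp [shiftPerm]
  linear_combination Ring.inverse (A 0 0) * hxy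

/-- The number of invertible matrices with a given nilpotent permanent does not depend on that
permanent. -/
theorem g_eq_g_zero_of_isNilpotent {n : ℕ} {x : ℤ} (hx : IsNilpotent (x : ZMod n)) :
    g n x = g n 0 := by
  have key (y : ZMod n) (A : {A : Matrix (Fin 2) (Fin 2) (ZMod n) // IsUnit A ∧ perm2 A = y})
      (hy : IsNilpotent y) : IsUnit (A.1 0 0) :=
    isUnit_apply_zero_zero_of_isNilpotent_perm2 A.2.1 (by rwa [A.2.2])
  have h0 : IsNilpotent ((0 : ℤ) : ZMod n) := by simp
  refine Nat.card_congr
    { toFun := fun A => ⟨shiftPerm (-(x : ZMod n)) A.1,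
        isUnit_shiftPerm hx.neg A.2.1 (key _ A hx), ?_⟩
      invFun := fun A => ⟨shiftPerm (x : ZMod n) A.1,
        isUnit_shiftPerm hx A.2.1 (key _ A h0), ?_⟩
      left_inv := fun A => Subtype.ext (shiftPerm_shiftPerm (add_neg_cancel _) A.1)
      right_inv := fun A => Subtype.ext (shiftPerm_shiftPerm (neg_add_cancel _) A.1) }
  · rw [perm2_shiftPerm _ (key _ A hx), A.2.2]
    simp
  · rw [perm2_shiftPerm _ (key _ A h0), A.2.2]
    simp

theorem g_prime_pow_pow (p k : ℕ) (hp : p.Prime) (hk : 1 ≤ k)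
    (i : ℕ) (hi1 : 1 ≤ i) (hik : i ≤ k) :
    g (p ^ k) ((p : ℤ) ^ i) = g (p ^ k) 0 := by
  have hp_nil : IsNilpotent (p : ZMod (p ^ k)) :=
    ⟨k, by rw [← Nat.cast_pow, ZMod.natCast_self]⟩
  apply g_eq_g_zero_of_isNilpotent
  rw [Int.cast_pow, Int.cast_natCast]
  exact hp_nil.pow_of_pos (by omega)
end

section
/- Let n ≥ 1 and let a, b be positive integers with gcd(a, n) = gcd(b, n). Then g_n(a) = g_n(b). -/
theorem ZMod.exists_unit_mul_gcd {n : ℕ} [NeZero n] (a : ℕ) :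
    ∃ u : (ZMod n)ˣ, (a : ZMod n) = u * (Nat.gcd a n : ℕ) := by
  obtain ⟨d, hd, u, hu, h⟩ := ZMod.eq_unit_mul_divisor (a : ZMod n)
  obtain ⟨u, rfl⟩ := hu
  refine ⟨u, ?_⟩
  suffices Nat.gcd a n = d by rw [this, h]
  have hmod : a ≡ (u : ZMod n).val * d [MOD n] := by
    rw [← ZMod.natCast_eq_natCast_iff, h]
    simp
  rw [hmod.gcd_eq, Nat.Coprime.gcd_mul_left_cancel d (ZMod.val_coe_unit_coprime u),
    Nat.gcd_eq_left hd]

theorem perm2_diagonal_mul {n : ℕ} (w : ZMod n) (A : Matrix (Fin 2) (Fin 2) (ZMod n)) :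
    perm2 (Matrix.diagonal ![w, 1] * A) = w * perm2 A := by
  simp [perm2, Matrix.diagonal_mul]
  ring

theorem g_eq_of_unit_mul {n : ℕ} {x y : ℤ} (w : (ZMod n)ˣ) (h : (y : ZMod n) = w * x) :
    g n x = g n y := by
  have hw : IsUnit (Matrix.diagonal ![(w : ZMod n), 1]) := by
    simp [Matrix.isUnit_iff_isUnit_det]
  refine Nat.card_congr ((Units.mulLeft hw.unit).subtypeEquiv fun A => ?_)
  rw [Units.mulLeft_apply, IsUnit.unit_spec, perm2_diagonal_mul, h, w.isUnit.mul_right_inj,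
    ← hw.unit_spec, Units.isUnit_units_mul]

theorem g_gcd_invariance (n : ℕ) (hn : 1 ≤ n) (a b : ℕ) (ha : 0 < a) (hb : 0 < b)
    (h : Nat.gcd a n = Nat.gcd b n) :
    g n a = g n b := by
  have : NeZero n := ⟨by omega⟩
  obtain ⟨u, hu⟩ := ZMod.exists_unit_mul_gcd (n := n) a
  obtain ⟨v, hv⟩ := ZMod.exists_unit_mul_gcd (n := n) b
  refine g_eq_of_unit_mul (v * u⁻¹) ?_
  rw [Int.cast_natCast, Int.cast_natCast, hu, hv, h, Units.val_mul, mul_assoc,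
    Units.inv_mul_cancel_left]
end
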